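/- If L is an integer with L > (l−1)·n(n+1)(n+2)/6 (the number (l−1)·Σ_{β>0} height(β) for the positive roots of sl_{n+1}), then for any indices i_1, i_2, …, i_L ∈ {1,…,n} the composite operator E_{i_L}E_{i_{L−1}}···E_{i_1} is the zero operator on 𝒱. -/

import Mathlib

noncomputable section

/-- The index set `M` of tuples `m = (m_{jk})_{1 ≤ j ≤ k ≤ n}` with entries in `ℤ/lℤ`. -/
abbrev Mt (l n : ℕ) := {p : ℕ × ℕ // 1 ≤ p.1 ∧ p.1 ≤ p.2 ∧ p.2 ≤ n} → ZMod l

/-- The vector space `𝒱` with basis `(u_m)_{m ∈ M}`. -/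
abbrev Vsp (l n : ℕ) := Mt l n →₀ ℂ

/-- The basis vector `u_m` of `𝒱`. -/
def um {l n : ℕ} (m : Mt l n) : Vsp l n := Finsupp.single m 1

/-- The tuple `δ_{jk}` with `(j,k)`-entry `1` and all other entries `0`
(it is `0` if `(j,k)` is out of range). -/
def dlt {l n : ℕ} (j k : ℕ) : Mt l n := fun p => if p.val = (j, k) then 1 else 0

/-- The `(j,k)`-entry of `m`, read as `0` outside the range `1 ≤ j ≤ k ≤ n`. -/
def mval {l n : ℕ} (m : Mt l n) (j k : ℕ) : ZMod l :=
  if h : 1 ≤ j ∧ j ≤ k ∧ k ≤ n then m ⟨(j, k), h⟩ else 0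

/-- The shift operator `u_m ↦ u_{m + ξ}` on `𝒱`. -/
def shiftOp {l n : ℕ} (ξ : Mt l n) : Module.End ℂ (Vsp l n) :=
  Finsupp.lmapDomain ℂ ℂ (fun m => m + ξ)

/-- The diagonal operator `u_m ↦ f(m) • u_m` on `𝒱`. -/
def diagOp {l n : ℕ} (f : Mt l n → ℂ) : Module.End ℂ (Vsp l n) :=
  Finsupp.lsum ℂ (fun m => f m • Finsupp.lsingle m)

/-- `ε^a` for `a ∈ ℤ/lℤ`, well defined via the canonical representative since `ε^l = 1`. -/
def epow {l : ℕ} (ε : ℂ) (a : ZMod l) : ℂ := ε ^ a.val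

/-- The operator `X_{jk} : u_m ↦ ε^{m_{jk}} u_m` (the identity for out-of-range `(j,k)`). -/
def Xop (l n : ℕ) (ε : ℂ) (j k : ℕ) : Module.End ℂ (Vsp l n) :=
  diagOp (fun m => epow ε (mval m j k))

/-- The inverse operator `X_{jk}⁻¹ : u_m ↦ ε^{-m_{jk}} u_m`. -/
def XopInv (l n : ℕ) (ε : ℂ) (j k : ℕ) : Module.End ℂ (Vsp l n) :=
  diagOp (fun m => (epow ε (mval m j k))⁻¹)

/-- `{c W} = (cW - c⁻¹W⁻¹)/(ε - ε⁻¹)` for the invertible shift operator `W = shiftOp ζ`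
(whose inverse is `shiftOp (-ζ)`). -/
def braceShift (l n : ℕ) (ε c : ℂ) (ζ : Mt l n) : Module.End ℂ (Vsp l n) :=
  (ε - ε⁻¹)⁻¹ • (c • shiftOp ζ - c⁻¹ • shiftOp (-ζ))

/-- The total shift of `Z_{ik} Z_{i,k-1} Z_{i-1,k-1}⁻¹ Z_{i+1,k}⁻¹`. -/
def zetaE (l n : ℕ) (i k : ℕ) : Mt l n :=
  dlt i k + dlt i (k - 1) - dlt (i - 1) (k - 1) - dlt (i + 1) k

/-- The total shift of
`Z_{i+1-k,n-k} Z_{i+1-k,n+1-k}⁻¹ Z_{i-k,n+1-k} Z_{i-k,n-k}⁻¹`. -/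
def zetaF (l n : ℕ) (i k : ℕ) : Mt l n :=
  dlt (i + 1 - k) (n - k) - dlt (i + 1 - k) (n + 1 - k) +
    dlt (i - k) (n + 1 - k) - dlt (i - k) (n - k)

/-- The total shift of `Z_{in}² Z_{i-1,n}⁻¹ Z_{i+1,n}⁻¹`. -/
def zetaT (l n : ℕ) (i : ℕ) : Mt l n :=
  dlt i n + dlt i n - dlt (i - 1) n - dlt (i + 1) n

/-- The product `X_{ik} X_{i,k+1} ⋯ X_{in}`. -/
def XprodE (l n : ℕ) (ε : ℂ) (i k : ℕ) : Module.End ℂ (Vsp l n) :=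
  (List.ofFn (fun t : Fin (n + 1 - k) => Xop l n ε i (k + (t : ℕ)))).prod

/-- The product `X_{i+1-k,n+1-k}⁻¹ X_{i+2-k,n+2-k}⁻¹ ⋯ X_{i,n}⁻¹`. -/
def XprodF (l n : ℕ) (ε : ℂ) (i k : ℕ) : Module.End ℂ (Vsp l n) :=
  (List.ofFn (fun t : Fin k =>
    XopInv l n ε (i + 1 - k + (t : ℕ)) (n + 1 - k + (t : ℕ)))).prod

/-- The representation operator `Φ_{r,s,a,b}(e_i)`. -/
def PhiE (l n : ℕ) (ε : ℂ) (r : ℕ → ℂ) (a b : ℕ → ℕ → ℂ) (i : ℕ) :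
    Module.End ℂ (Vsp l n) :=
  ∑ k ∈ Finset.Icc i n,
    (∏ t ∈ Finset.range (n + 1 - k), a i (k + t)) •
      (XprodE l n ε i k *
        braceShift l n ε
          (r i * (b i k * b i (k - 1) * (b (i - 1) (k - 1))⁻¹ * (b (i + 1) k)⁻¹))
          (zetaE l n i k))

/-- The representation operator `Φ_{r,s,a,b}(f_i)`. -/
def PhiF (l n : ℕ) (ε : ℂ) (s : ℕ → ℂ) (a b : ℕ → ℕ → ℂ) (i : ℕ) :
    Module.End ℂ (Vsp l n) :=
  ∑ k ∈ Finset.Icc 1 i,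
    (∏ t ∈ Finset.range k, a (i + 1 - k + t) (n + 1 - k + t))⁻¹ •
      (XprodF l n ε i k *
        braceShift l n ε
          (s i * (b (i + 1 - k) (n - k) * (b (i + 1 - k) (n + 1 - k))⁻¹ *
            b (i - k) (n + 1 - k) * (b (i - k) (n - k))⁻¹))
          (zetaF l n i k))

/-- The representation operator `Φ_{r,s,a,b}(t_i)`. -/
def PhiT (l n : ℕ) (ε : ℂ) (r s : ℕ → ℂ) (b : ℕ → ℕ → ℂ) (i : ℕ) :
    Module.End ℂ (Vsp l n) :=
  ((r i / s i) * (b i n ^ 2 * (b (i - 1) n)⁻¹ * (b (i + 1) n)⁻¹)) • shiftOp (zetaT l n i)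

/-- The specialized operator `E_i = Σ_{k=i}^n X_{ik}⋯X_{in} {Z_{ik}Z_{i,k-1}Z_{i-1,k-1}⁻¹Z_{i+1,k}⁻¹}`. -/
def Esp (l n : ℕ) (ε : ℂ) (i : ℕ) : Module.End ℂ (Vsp l n) :=
  ∑ k ∈ Finset.Icc i n, XprodE l n ε i k * braceShift l n ε 1 (zetaE l n i k)

/-- The specialized operator
`F_i = Σ_{k=1}^i X_{i+1-k,n+1-k}⁻¹⋯X_{i,n}⁻¹ {ε^{-λ_i} Z_{i+1-k,n-k}Z_{i+1-k,n+1-k}⁻¹Z_{i-k,n+1-k}Z_{i-k,n-k}⁻¹}`. -/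
def Fsp (l n : ℕ) (ε : ℂ) (lam : ℕ → ℕ) (i : ℕ) : Module.End ℂ (Vsp l n) :=
  ∑ k ∈ Finset.Icc 1 i, XprodF l n ε i k * braceShift l n ε ((ε ^ lam i)⁻¹) (zetaF l n i k)

/-- The specialized operator `T_i = ε^{λ_i} Z_{in}² Z_{i-1,n}⁻¹ Z_{i+1,n}⁻¹`. -/
def Tsp (l n : ℕ) (ε : ℂ) (lam : ℕ → ℕ) (i : ℕ) : Module.End ℂ (Vsp l n) :=
  (ε ^ lam i) • shiftOp (zetaT l n i)

/-- The inverse operator `T_i⁻¹`. -/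
def TspInv (l n : ℕ) (ε : ℂ) (lam : ℕ → ℕ) (i : ℕ) : Module.End ℂ (Vsp l n) :=
  (ε ^ lam i)⁻¹ • shiftOp (-(zetaT l n i))

section QCommutation

variable {A : Type*} [Ring A] [Algebra ℂ A]

/-- `a` and `b` commute up to the scalar `s`: `a b = s b a`. -/
def QComm (s : ℂ) (a b : A) : Prop := a * b = s • (b * a)

namespace QComm

variable {s t : ℂ} {a a' b c : A}

theorem of_eq (h : QComm s a b) (hst : s = t) : QComm t a b := hst ▸ h

theorem of_commute (h : Commute a b) : QComm 1 a b := by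
  rw [QComm, one_smul]; exact h

theorem eq_of_one (h : QComm 1 a b) : a * b = b * a := by
  rwa [QComm, one_smul] at h

theorem zero_left : QComm s 0 b := by simp [QComm]

theorem zero_right : QComm s a 0 := by simp [QComm]

theorem mul_left (h₁ : QComm s a c) (h₂ : QComm t b c) : QComm (s * t) (a * b) c := by
  unfold QComm at *
  rw [mul_assoc, h₂, mul_smul_comm, ← mul_assoc, h₁, smul_mul_assoc, smul_smul, mul_assoc,
    mul_comm t]

theorem mul_right (h₁ : QComm s a b) (h₂ : QComm t a c) : QComm (s * t) a (b * c) := by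
  unfold QComm at *
  rw [← mul_assoc, h₁, smul_mul_assoc, mul_assoc, h₂, mul_smul_comm, smul_smul, mul_assoc]

theorem add_left (h₁ : QComm s a c) (h₂ : QComm s b c) : QComm s (a + b) c := by
  unfold QComm at *
  rw [add_mul, mul_add, smul_add, h₁, h₂]

theorem sub_left (h₁ : QComm s a c) (h₂ : QComm s b c) : QComm s (a - b) c := by
  unfold QComm at *
  rw [sub_mul, mul_sub, smul_sub, h₁, h₂]

theorem add_right (h₁ : QComm s a b) (h₂ : QComm s a c) : QComm s a (b + c) := by
  unfold QComm at *
  rw [add_mul, mul_add, smul_add, h₁, h₂]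

theorem sub_right (h₁ : QComm s a b) (h₂ : QComm s a c) : QComm s a (b - c) := by
  unfold QComm at *
  rw [sub_mul, mul_sub, smul_sub, h₁, h₂]

theorem smul_left (r : ℂ) (h : QComm s a b) : QComm s (r • a) b := by
  unfold QComm at *
  rw [smul_mul_assoc, mul_smul_comm, h, smul_comm]

theorem smul_right (r : ℂ) (h : QComm s a b) : QComm s a (r • b) := by
  unfold QComm at *
  rw [smul_mul_assoc, mul_smul_comm, h, smul_comm]

theorem symm (hs : s ≠ 0) (h : QComm s a b) : QComm s⁻¹ b a := by
  unfold QComm at *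
  rw [h, smul_smul, inv_mul_cancel₀ hs, one_smul]

theorem symm_one (h : QComm 1 a b) : QComm 1 b a := by
  simpa using h.symm one_ne_zero

theorem inv_left (hs : s ≠ 0) (h₁ : a * a' = 1) (h₂ : a' * a = 1) (h : QComm s a b) :
    QComm s⁻¹ a' b := by
  unfold QComm at *
  have := congrArg (fun x => s⁻¹ • (a' * x * a')) h
  simp only [mul_smul_comm, smul_mul_assoc, smul_smul, inv_mul_cancel₀ hs, one_smul] at this
  rw [← mul_assoc a', h₂, one_mul, ← mul_assoc a', mul_assoc (a' * b), h₁, mul_one] at this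
  exact this.symm

theorem pow_right (h : QComm s a b) (k : ℕ) : QComm (s ^ k) a (b ^ k) := by
  induction k with
  | zero => simp [QComm]
  | succ k ih => rw [pow_succ, pow_succ]; exact ih.mul_right h

theorem mul_pow (h : QComm s b a) (k : ℕ) :
    (a * b) ^ k = s ^ k.choose 2 • (a ^ k * b ^ k) := by
  induction k with
  | zero => simp
  | succ k ih =>
    have hk : b * a ^ k = s ^ k • (a ^ k * b) := h.pow_right k
    rw [pow_succ', ih, mul_smul_comm, mul_assoc, ← mul_assoc b, hk, smul_mul_assoc,
      mul_smul_comm, smul_smul, ← pow_add, Nat.choose_succ_succ' k 1, Nat.choose_one_right,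
      add_comm k, pow_succ' a, pow_succ' b]
    simp only [mul_assoc]

theorem mul_pow_eq_zero (h : QComm s b a) {k : ℕ} (hk : b ^ k = 0) : (a * b) ^ k = 0 := by
  rw [h.mul_pow, hk, mul_zero, smul_zero]

end QComm

/-- The Gaussian binomial coefficients, by the `q`-Pascal recursion. -/
def gaussCoeff (s : ℂ) : ℕ → ℕ → ℂ
  | _, 0 => 1
  | 0, _ + 1 => 0
  | n + 1, k + 1 => gaussCoeff s n k + s ^ (k + 1) * gaussCoeff s n (k + 1)

theorem gaussCoeff_zero_right (s : ℂ) (n : ℕ) : gaussCoeff s n 0 = 1 := by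
  cases n <;> rfl

theorem gaussCoeff_eq_zero_of_lt (s : ℂ) {n k : ℕ} (h : n < k) : gaussCoeff s n k = 0 := by
  induction n generalizing k with
  | zero => obtain ⟨k, rfl⟩ := Nat.exists_eq_succ_of_ne_zero h.ne'; rfl
  | succ n ih =>
    obtain ⟨k, rfl⟩ := Nat.exists_eq_succ_of_ne_zero (Nat.ne_zero_of_lt h)
    simp only [gaussCoeff]
    rw [ih (by omega), ih (by omega)]; simp

theorem gaussCoeff_self (s : ℂ) (n : ℕ) : gaussCoeff s n n = 1 := by
  induction n with
  | zero => rfl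
  | succ n ih => simp [gaussCoeff, ih, gaussCoeff_eq_zero_of_lt]

theorem gaussCoeff_succ_mul (s : ℂ) (n k : ℕ) :
    s ^ k * (s ^ (k + 1) - 1) * gaussCoeff s n (k + 1) =
      (s ^ n - s ^ k) * gaussCoeff s n k := by
  induction n generalizing k with
  | zero =>
    cases k with
    | zero => simp [gaussCoeff]
    | succ k => simp [gaussCoeff]
  | succ n ih =>
    cases k with
    | zero =>
      have := ih 0
      simp only [gaussCoeff, gaussCoeff_zero_right] at this ⊢
      linear_combination s * this
    | succ k =>
      have h₁ := ih (k + 1)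
      have h₂ := ih k
      simp only [gaussCoeff]
      linear_combination s ^ (k + 2) * h₁ + s * h₂

theorem gaussCoeff_primitiveRoot {s : ℂ} {l k : ℕ} (hs : IsPrimitiveRoot s l)
    (hk : 0 < k) (hkl : k < l) : gaussCoeff s l k = 0 := by
  induction k with
  | zero => omega
  | succ k ih =>
    have h := gaussCoeff_succ_mul s l k
    have hs0 : s ≠ 0 := hs.ne_zero (by omega)
    have hz : (s ^ l - s ^ k) * gaussCoeff s l k = 0 := by
      rcases Nat.eq_zero_or_pos k with rfl | hk'
      · simp [hs.pow_eq_one]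
      · rw [ih hk' (by omega), mul_zero]
    rw [hz] at h
    have h1 : s ^ (k + 1) - 1 ≠ 0 := sub_ne_zero.2 (hs.pow_ne_one_of_pos_of_lt (by omega) hkl)
    simpa [hs0, h1] using h

variable {A : Type*} [Ring A] [Algebra ℂ A]

theorem QComm.add_pow {s : ℂ} {a b : A} (h : QComm s b a) (n : ℕ) :
    (a + b) ^ n = ∑ k ∈ Finset.range (n + 1), gaussCoeff s n k • (a ^ k * b ^ (n - k)) := by
  induction n with
  | zero => simp [gaussCoeff]
  | succ n ih =>
    have hb : ∀ k, b * a ^ k = s ^ k • (a ^ k * b) := h.pow_right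
    have hb' : b * ∑ k ∈ Finset.range (n + 1), gaussCoeff s n k • (a ^ k * b ^ (n - k)) =
        ∑ k ∈ Finset.range (n + 2), (s ^ k * gaussCoeff s n k) • (a ^ k * b ^ (n + 1 - k)) := by
      rw [Finset.sum_range_succ _ (n + 1), gaussCoeff_eq_zero_of_lt s (Nat.lt_succ_self n),
        mul_zero, zero_smul, add_zero, Finset.mul_sum]
      refine Finset.sum_congr rfl fun k hk => ?_
      have hk' : n + 1 - k = n - k + 1 := by
        have := Finset.mem_range.1 hk
        omega
      rw [mul_smul_comm, ← mul_assoc, hb, smul_mul_assoc, mul_assoc, ← pow_succ', hk', smul_smul,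
        mul_comm (gaussCoeff s n k)]
    rw [pow_succ', ih, add_mul, hb', Finset.sum_range_succ' _ (n + 1),
      Finset.sum_range_succ' _ (n + 1), Finset.mul_sum, ← add_assoc, ← Finset.sum_add_distrib]
    congr 1
    · refine Finset.sum_congr rfl fun k _ => ?_
      rw [mul_smul_comm, ← mul_assoc, ← pow_succ', Nat.add_sub_add_right, ← add_smul]
      rfl
    · simp [gaussCoeff_zero_right]

theorem QComm.add_pow_primitiveRoot {s : ℂ} {l : ℕ} (hs : IsPrimitiveRoot s l) (hl : 0 < l)
    {a b : A} (h : QComm s b a) : (a + b) ^ l = a ^ l + b ^ l := by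
  obtain ⟨m, rfl⟩ : ∃ m, l = m + 1 := ⟨l - 1, by omega⟩
  rw [h.add_pow, Finset.sum_range_succ, Finset.sum_range_succ', Finset.sum_eq_zero]
  · simp [gaussCoeff_zero_right, gaussCoeff_self, add_comm]
  · intro k hk
    rw [gaussCoeff_primitiveRoot hs (Nat.succ_pos k)
      (by have := Finset.mem_range.1 hk; omega), zero_smul]

end QCommutation

section RootVectors

variable {A : Type*} [Ring A] [Algebra ℂ A]

/-- The root vector attached to `α_j + ⋯ + α_{j+t}`, an iterated `q`-commutator of the `e i`. -/
def rootVec (q : ℂ) (e : ℕ → A) (j : ℕ) : ℕ → A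
  | 0 => e j
  | t + 1 => rootVec q e j t * e (j + t + 1) - q • (e (j + t + 1) * rootVec q e j t)

/-- The quantum Serre relations of type `A`. -/
structure QSerre (q : ℂ) (e : ℕ → A) : Prop where
  far : ∀ i j, i + 2 ≤ j → QComm 1 (e i) (e j)
  left : ∀ i, QComm q (rootVec q e i 1) (e i)
  right : ∀ i, QComm q⁻¹ (rootVec q e i 1) (e (i + 1))

variable {q : ℂ} {e : ℕ → A}

theorem QComm.rootVec_succ {s u : ℂ} {a : A} {j t : ℕ} (h₁ : QComm s a (rootVec q e j t))
    (h₂ : QComm u a (e (j + t + 1))) : QComm (s * u) a (rootVec q e j (t + 1)) :=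
  (h₁.mul_right h₂).sub_right (((h₂.mul_right h₁).of_eq (mul_comm _ _)).smul_right q)

theorem QComm.rootVec_one {a : A} {j t : ℕ} (h : ∀ i, j ≤ i → i ≤ j + t → QComm 1 a (e i)) :
    QComm 1 a (rootVec q e j t) := by
  induction t with
  | zero => exact h j le_rfl le_rfl
  | succ t ih =>
    exact ((ih fun i h₁ h₂ => h i h₁ (by omega)).rootVec_succ
      (h _ (by omega) (by omega))).of_eq (one_mul 1)

theorem rootVec_eq_zero {j t : ℕ} (h : e (j + t) = 0) : rootVec q e j t = 0 := by
  cases t with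
  | zero => exact h
  | succ t => rw [rootVec, add_assoc, h]; simp

namespace QSerre

theorem far' (h : QSerre q e) {i j : ℕ} (hij : i + 2 ≤ j ∨ j + 2 ≤ i) : QComm 1 (e i) (e j) :=
  hij.elim (h.far i j) fun h' => (h.far j i h').symm_one

theorem rootVec_succ_left (h : QSerre q e) (j t : ℕ) :
    rootVec q e j (t + 1) =
      e j * rootVec q e (j + 1) t - q • (rootVec q e (j + 1) t * e j) := by
  induction t with
  | zero => rfl
  | succ t ih =>
    have hc : e (j + t + 2) * e j = e j * e (j + t + 2) :=
      (h.far' (Or.inr (by omega))).eq_of_one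
    have h2 : rootVec q e (j + 1) (t + 1) = rootVec q e (j + 1) t * e (j + t + 2) -
        q • (e (j + t + 2) * rootVec q e (j + 1) t) := by
      rw [rootVec, show j + 1 + t + 1 = j + t + 2 by omega]
    rw [h2, rootVec.eq_2 q e j (t + 1), ih]
    have hc1 : ∀ r, e (j + t + 2) * (e j * r) = e j * (e (j + t + 2) * r) := fun r => by
      rw [← mul_assoc, hc, mul_assoc]
    change _ * e (j + t + 2) - q • (e (j + t + 2) * _) = _
    simp only [sub_mul, mul_sub, smul_mul_assoc, mul_smul_comm, mul_assoc, hc, hc1, smul_sub]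
    abel

theorem comm_rootVec_succ_left (h : QSerre q e) {s u : ℂ} {a : A} {j t : ℕ}
    (h₁ : QComm s a (e j)) (h₂ : QComm u a (rootVec q e (j + 1) t)) :
    QComm (s * u) a (rootVec q e j (t + 1)) := by
  rw [h.rootVec_succ_left]
  exact (h₁.mul_right h₂).sub_right (((h₂.mul_right h₁).of_eq (mul_comm _ _)).smul_right q)

theorem far_right (h : QSerre q e) {i j t : ℕ} (hi : j + t + 2 ≤ i) :
    QComm 1 (e i) (rootVec q e j t) :=
  QComm.rootVec_one fun k _ _ => h.far' (Or.inr (by omega))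

theorem rootVec_last (h : QSerre q e) (hq : q ≠ 0) (j t : ℕ) :
    QComm q (e (j + t + 1)) (rootVec q e j (t + 1)) := by
  induction t generalizing j with
  | zero => exact ((h.right j).symm (inv_ne_zero hq)).of_eq (inv_inv q)
  | succ t ih =>
    have := ih (j + 1)
    rw [show j + 1 + t + 1 = j + (t + 1) + 1 by omega] at this
    exact (h.comm_rootVec_succ_left (h.far' (Or.inr (by omega))) this).of_eq (one_mul _)

theorem comm_rootVec_two (h : QSerre q e) (hq : q ≠ 0) (hq2 : 1 + q ^ 2 ≠ 0) (j : ℕ) :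
    QComm 1 (e (j + 1)) (rootVec q e j 2) := by
  set a := e j
  set b := e (j + 1)
  set c := e (j + 2)
  set T := rootVec q e j 2
  set P := rootVec q e j 1
  set C := rootVec q e (j + 1) 1
  have hT : T = a * C - q • (C * a) := h.rootVec_succ_left j 1
  have hT' : T = P * c - q • (c * P) := rfl
  have hP : P = a * b - q • (b * a) := rfl
  have hC : C = b * c - q • (c * b) := rfl
  have hPb : P * b = q⁻¹ • (b * P) := h.right j
  have hCb : C * b = q • (b * C) := h.left (j + 1)
  have hbP : b * P = q • (P * b) := by rw [hPb, smul_smul, mul_inv_cancel₀ hq, one_smul]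
  have hbC : b * C = q⁻¹ • (C * b) := by rw [hCb, smul_smul, inv_mul_cancel₀ hq, one_smul]
  have hab : a * b = P + q • (b * a) := by rw [hP]; abel
  have hbc : b * c = C + q • (c * b) := by rw [hC]; abel
  have h₁ : T * b - q ^ 2 • (b * T) = q • (P * C - C * P) := by
    have e1 : a * C * b = q • (P * C) + q ^ 2 • (b * a * C) := by
      rw [mul_assoc, hCb, mul_smul_comm, ← mul_assoc, hab, add_mul, smul_add, smul_mul_assoc,
        smul_smul, sq]
    have e2 : C * a * b = C * P + q ^ 2 • (b * C * a) := by
      rw [mul_assoc, hab, mul_add, mul_smul_comm, ← mul_assoc C, hCb, smul_mul_assoc, smul_smul,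
        sq]
    rw [hT, sub_mul, smul_mul_assoc, e1, e2, mul_sub, mul_smul_comm]
    simp only [mul_assoc]
    module
  have h₂ : b * T - q ^ 2 • (T * b) = q • (P * C - C * P) := by
    have e1 : b * P * c = q • (P * C) + q ^ 2 • (P * c * b) := by
      rw [hbP, smul_mul_assoc, mul_assoc, hbc, mul_add, smul_add, mul_smul_comm, smul_smul, sq,
        mul_assoc]
    have e2 : b * c * P = C * P + q ^ 2 • (c * P * b) := by
      rw [hbc, add_mul, smul_mul_assoc, mul_assoc c, hbP, mul_smul_comm, smul_smul, sq, mul_assoc]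
    rw [hT', mul_sub, mul_smul_comm, ← mul_assoc, ← mul_assoc, e1, e2, sub_mul, smul_mul_assoc]
    module
  have h₃ : (1 + q ^ 2) • (b * T - T * b) = 0 := by
    have := sub_eq_zero.2 (h₂.trans h₁.symm)
    rw [← this]
    module
  rw [QComm, one_smul]
  exact sub_eq_zero.1 ((smul_eq_zero.1 h₃).resolve_left hq2)

theorem comm_rootVec_inner (h : QSerre q e) (hq : q ≠ 0) (hq2 : 1 + q ^ 2 ≠ 0) {i j t : ℕ}
    (h₁ : j < i) (h₂ : i < j + t) : QComm 1 (e i) (rootVec q e j t) := by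
  obtain ⟨k, rfl⟩ := Nat.exists_eq_add_of_lt h₁
  obtain ⟨m, rfl⟩ := Nat.exists_eq_add_of_lt (show k + 1 < t by omega)
  induction k generalizing j with
  | zero =>
    clear h₁ h₂
    induction m with
    | zero => exact h.comm_rootVec_two hq hq2 j
    | succ m ih =>
      exact (ih.rootVec_succ (h.far' (Or.inl (by omega)))).of_eq (one_mul 1)
  | succ k ih =>
    have := @ih (j + 1) (by omega) (by omega)
    rw [show j + 1 + k + 1 = j + (k + 1) + 1 by omega] at this
    rw [show k + 1 + 1 + m + 1 = k + 1 + m + 1 + 1 by omega]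
    exact (h.comm_rootVec_succ_left (h.far' (Or.inr (by omega))) this).of_eq (one_mul 1)

theorem rootVec_first (h : QSerre q e) (hq : q ≠ 0) (j t : ℕ) :
    QComm q⁻¹ (e j) (rootVec q e j (t + 1)) := by
  induction t with
  | zero => exact (h.left j).symm hq
  | succ t ih => exact (ih.rootVec_succ (h.far' (Or.inl (by omega)))).of_eq (mul_one _)

theorem comm_rootVec_same (h : QSerre q e) (hq : q ≠ 0) (hq2 : 1 + q ^ 2 ≠ 0) (j : ℕ) {s t : ℕ}
    (hst : s < t) : QComm q (rootVec q e j t) (rootVec q e j s) := by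
  induction s with
  | zero =>
    obtain ⟨t, rfl⟩ := Nat.exists_eq_succ_of_ne_zero hst.ne'
    exact ((h.rootVec_first hq j t).symm (inv_ne_zero hq)).of_eq (inv_inv q)
  | succ s ih =>
    exact ((ih (by omega)).rootVec_succ
      (h.comm_rootVec_inner hq hq2 (by omega) (by omega)).symm_one).of_eq (mul_one q)

theorem comm_rootVec_tail (h : QSerre q e) (hq : q ≠ 0) (hq2 : 1 + q ^ 2 ≠ 0) (j t : ℕ) :
    QComm q⁻¹ (rootVec q e j (t + 1)) (rootVec q e (j + 1) t) := by
  cases t with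
  | zero => exact h.right j
  | succ t =>
    have h₁ : QComm 1 (rootVec q e j (t + 2)) (rootVec q e (j + 1) t) :=
      QComm.rootVec_one fun i hi hi' =>
        (h.comm_rootVec_inner hq hq2 (by omega) (by omega)).symm_one
    have h₂ := (h.rootVec_last hq j (t + 1)).symm hq
    rw [show j + (t + 1) + 1 = j + 1 + t + 1 by omega] at h₂
    exact (h₁.rootVec_succ h₂).of_eq (one_mul _)

end QSerre
end RootVectors

section Vanishing

variable {A : Type*} [Ring A] [Algebra ℂ A]

theorem QComm.list_prod_eq_pow_count {f : ℕ → A} (hf : ∀ a b, ∃ s, QComm s (f a) (f b)) (t : ℕ)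
    (τ : List ℕ) : ∃ y, (τ.map f).prod = f t ^ τ.count t * y := by
  induction τ with
  | nil => exact ⟨1, by simp⟩
  | cons b τ ih =>
    obtain ⟨y, hy⟩ := ih
    rw [List.map_cons, List.prod_cons, hy]
    by_cases hb : b = t
    · subst hb
      exact ⟨y, by rw [List.count_cons_self, pow_succ', mul_assoc]⟩
    · obtain ⟨s, hs⟩ := hf b t
      have := hs.pow_right (τ.count t)
      refine ⟨s ^ τ.count t • (f b * y), ?_⟩
      rw [List.count_cons_of_ne hb, ← mul_assoc, this, smul_mul_assoc, mul_assoc, mul_smul_comm]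

theorem QComm.list_prod_eq_zero {f : ℕ → A} (hf : ∀ a b, ∃ s, QComm s (f a) (f b)) {l t : ℕ}
    (ht : f t ^ l = 0) {τ : List ℕ} (hτ : l ≤ τ.count t) : (τ.map f).prod = 0 := by
  obtain ⟨y, hy⟩ := QComm.list_prod_eq_pow_count hf t τ
  rw [hy, pow_eq_zero_of_le hτ ht, zero_mul]

theorem List.sum_map_succ_le {l d : ℕ} {τ : List ℕ} (hd : ∀ t ∈ τ, t < d)
    (hc : ∀ t, τ.count t ≤ l) :
    (τ.map (· + 1)).sum ≤ l * ∑ t ∈ Finset.range d, (t + 1) := by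
  rw [Finset.sum_list_map_count, Finset.mul_sum]
  calc _ ≤ ∑ m ∈ τ.toFinset, l * (m + 1) :=
        Finset.sum_le_sum fun m _ => by simpa using Nat.mul_le_mul_right (m + 1) (hc m)
    _ ≤ _ := Finset.sum_le_sum_of_subset fun m hm =>
        Finset.mem_range.2 (hd m (List.mem_toFinset.1 hm))

/-- The span of the products of root vectors starting at `j` with a word in the `e i`, `j < i`,
of total height `d`. -/
def pbwSpan (q : ℂ) (e : ℕ → A) (j d : ℕ) : Submodule ℂ A :=
  Submodule.span ℂ {x | ∃ τ κ : List ℕ, (∀ i ∈ κ, j < i) ∧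
    (τ.map (· + 1)).sum + κ.length = d ∧ x = (τ.map (rootVec q e j)).prod * (κ.map e).prod}

variable {q : ℂ} {e : ℕ → A}

theorem rootVec_mul_mem_pbwSpan {j t d : ℕ} {x : A} (hx : x ∈ pbwSpan q e j d) :
    rootVec q e j t * x ∈ pbwSpan q e j (d + t + 1) := by
  refine Submodule.span_induction (p := fun x _ => rootVec q e j t * x ∈ pbwSpan q e j (d + t + 1))
    ?_ (by simp) (fun x y _ _ hx hy => by rw [mul_add]; exact add_mem hx hy)
    (fun c x _ hx => by rw [mul_smul_comm]; exact Submodule.smul_mem _ c hx) hx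
  rintro _ ⟨τ, κ, hκ, hd, rfl⟩
  refine Submodule.subset_span ⟨t :: τ, κ, hκ, ?_, ?_⟩
  · simp only [List.map_cons, List.sum_cons]; omega
  · simp [mul_assoc]

namespace QSerre

theorem exists_qComm_of_ne (h : QSerre q e) (hq : q ≠ 0) (hq2 : 1 + q ^ 2 ≠ 0) {i j t : ℕ}
    (hij : j < i) (hne : i ≠ j + t + 1) : ∃ s, QComm s (e i) (rootVec q e j t) := by
  rcases lt_trichotomy i (j + t) with hlt | rfl | hlt
  · exact ⟨1, h.comm_rootVec_inner hq hq2 hij hlt⟩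
  · obtain ⟨t, rfl⟩ := Nat.exists_eq_succ_of_ne_zero (show t ≠ 0 by omega)
    exact ⟨q, h.rootVec_last hq j t⟩
  · exact ⟨1, h.far_right (by omega)⟩

theorem exists_qComm_rootVec (h : QSerre q e) (hq : q ≠ 0) (hq2 : 1 + q ^ 2 ≠ 0) (j a b : ℕ) :
    ∃ s, QComm s (rootVec q e j a) (rootVec q e j b) := by
  rcases lt_trichotomy a b with hlt | rfl | hlt
  · exact ⟨q⁻¹, (h.comm_rootVec_same hq hq2 j hlt).symm hq⟩
  · exact ⟨1, QComm.of_commute (Commute.refl _)⟩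
  · exact ⟨q, h.comm_rootVec_same hq hq2 j hlt⟩

theorem mul_mem_pbwSpan (h : QSerre q e) (hq : q ≠ 0) (hq2 : 1 + q ^ 2 ≠ 0) {i j d : ℕ}
    (hij : j ≤ i) {x : A} (hx : x ∈ pbwSpan q e j d) : e i * x ∈ pbwSpan q e j (d + 1) := by
  rcases hij.eq_or_lt with rfl | hij
  · exact rootVec_mul_mem_pbwSpan (t := 0) hx
  refine Submodule.span_induction (p := fun x _ => e i * x ∈ pbwSpan q e j (d + 1))
    ?_ (by simp) (fun x y _ _ hx hy => by rw [mul_add]; exact add_mem hx hy)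
    (fun c x _ hx => by rw [mul_smul_comm]; exact Submodule.smul_mem _ c hx) hx
  rintro _ ⟨τ, κ, hκ, rfl, rfl⟩
  clear hx
  induction τ with
  | nil =>
    refine Submodule.subset_span ⟨[], i :: κ, ?_, ?_, ?_⟩
    · simpa using ⟨hij, hκ⟩
    · simp
    · simp
  | cons t τ ih =>
    set y := (τ.map (rootVec q e j)).prod * (κ.map e).prod
    have hy : y ∈ pbwSpan q e j ((τ.map (· + 1)).sum + κ.length) :=
      Submodule.subset_span ⟨τ, κ, hκ, rfl, rfl⟩
    have h₁ := rootVec_mul_mem_pbwSpan (t := t) ih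
    have h₂ := rootVec_mul_mem_pbwSpan (t := t + 1) hy
    rw [show ((t :: τ).map (· + 1)).sum + κ.length + 1 =
      (τ.map (· + 1)).sum + κ.length + 1 + t + 1 by
        simp only [List.map_cons, List.sum_cons]; omega,
      List.map_cons, List.prod_cons, mul_assoc]
    rw [show (τ.map (· + 1)).sum + κ.length + (t + 1) + 1 =
      (τ.map (· + 1)).sum + κ.length + 1 + t + 1 by omega] at h₂
    by_cases hit : i = j + t + 1
    · have : e i * (rootVec q e j t * y) =
          q⁻¹ • (rootVec q e j t * (e i * y) - rootVec q e j (t + 1) * y) := by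
        rw [rootVec.eq_2, ← hit, sub_mul, mul_assoc, sub_sub_cancel, smul_mul_assoc, smul_smul,
          inv_mul_cancel₀ hq, one_smul, mul_assoc]
      rw [this]
      exact Submodule.smul_mem _ _ (sub_mem h₁ h₂)
    · obtain ⟨s, hs⟩ := h.exists_qComm_of_ne hq hq2 hij hit
      have : e i * (rootVec q e j t * y) = s • (rootVec q e j t * (e i * y)) := by
        rw [← mul_assoc, hs, smul_mul_assoc, mul_assoc]
      rw [this]
      exact Submodule.smul_mem _ _ h₁

theorem prod_mem_pbwSpan (h : QSerre q e) (hq : q ≠ 0) (hq2 : 1 + q ^ 2 ≠ 0) {j : ℕ}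
    {κ : List ℕ} (hκ : ∀ i ∈ κ, j ≤ i) : (κ.map e).prod ∈ pbwSpan q e j κ.length := by
  induction κ with
  | nil => exact Submodule.subset_span ⟨[], [], by simp⟩
  | cons i κ ih =>
    rw [List.map_cons, List.prod_cons]
    exact h.mul_mem_pbwSpan hq hq2 (hκ i (by simp)) (ih fun i hi => hκ i (by simp [hi]))

/-- Words in the `e i`, `j ≤ i < n`, of length exceeding `l - 1` times the sum of the heights of
the positive roots vanish when all root vectors are nilpotent of order `l`. -/
theorem prod_eq_zero (h : QSerre q e) (hq : q ≠ 0) (hq2 : 1 + q ^ 2 ≠ 0) {l n : ℕ} (hl : 0 < l)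
    (hn : ∀ i, n ≤ i → e i = 0) (hpow : ∀ j t, rootVec q e j t ^ l = 0) {d j : ℕ} (hd : n ≤ j + d)
    {κ : List ℕ} (hκ : ∀ i ∈ κ, j ≤ i)
    (hlen : (l - 1) * ∑ c ∈ Finset.range d, ∑ t ∈ Finset.range (c + 1), (t + 1) < κ.length) :
    (κ.map e).prod = 0 := by
  induction d generalizing j κ with
  | zero =>
    cases κ with
    | nil => simp at hlen
    | cons i κ =>
      rw [List.map_cons, List.prod_cons, hn i (hd.trans (hκ i (by simp))), zero_mul]
  | succ d ih =>
    have key : pbwSpan q e j κ.length ≤ ⊥ := by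
      refine Submodule.span_le.2 ?_
      rintro _ ⟨τ, μ, hμ, hsum, rfl⟩
      change _ = (0 : A)
      by_cases hmem : ∀ t ∈ τ, t < d + 1
      · by_cases hc : ∀ t, τ.count t ≤ l - 1
        · rw [ih (j := j + 1) (κ := μ) (by omega) hμ, mul_zero]
          have := List.sum_map_succ_le hmem hc
          rw [Finset.sum_range_succ, mul_add] at hlen
          omega
        · push Not at hc
          obtain ⟨t, ht⟩ := hc
          rw [QComm.list_prod_eq_zero (h.exists_qComm_rootVec hq hq2 j) (hpow j t)
            (by omega), zero_mul]
      · push Not at hmem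
        obtain ⟨t, ht, hlt⟩ := hmem
        rw [List.prod_eq_zero (l := τ.map (rootVec q e j)), zero_mul]
        exact List.mem_map.2 ⟨t, ht, rootVec_eq_zero (hn _ (by omega))⟩
    exact (Submodule.mem_bot ℂ).1 (key (h.prod_mem_pbwSpan hq hq2 hκ))

end QSerre

theorem sum_heights (n : ℕ) :
    6 * ∑ c ∈ Finset.range n, ∑ t ∈ Finset.range (c + 1), (t + 1) = n * (n + 1) * (n + 2) := by
  have h : ∀ m, 2 * ∑ t ∈ Finset.range m, (t + 1) = m * (m + 1) := fun m => by
    induction m with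
    | zero => simp
    | succ m ih => rw [Finset.sum_range_succ, mul_add, ih]; ring
  induction n with
  | zero => simp
  | succ n ih =>
    rw [Finset.sum_range_succ, mul_add, ih, show (6 : ℕ) = 3 * 2 by norm_num, mul_assoc 3 2, h]
    ring

end Vanishing

section Extension

variable {A : Type*} [Ring A] [Algebra ℂ A]

/-- Operators `X i`, `W i` (with inverse `W' i`), `i < N`, commuting up to powers of `q` among
themselves and with the generators `e i` of the preceding level. -/
structure QExtension (q : ℂ) (N : ℕ) (e X W W' : ℕ → A) : Prop where
  XX : ∀ i j, QComm 1 (X i) (X j)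
  Xe : ∀ i j, QComm 1 (X i) (e j)
  WW : ∀ i j, QComm 1 (W i) (W j)
  WX_self : ∀ i, i < N → QComm q⁻¹ (W i) (X i)
  WX_succ : ∀ i, i + 1 < N → QComm q (W i) (X (i + 1))
  WX : ∀ i j, j ≠ i → j ≠ i + 1 → QComm 1 (W i) (X j)
  We_self : ∀ i, QComm q⁻¹ (W i) (e i)
  We_pred : ∀ i, QComm q (W (i + 1)) (e i)
  We : ∀ i j, i ≠ j → i ≠ j + 1 → QComm 1 (W i) (e j)
  mul_inv : ∀ i, W i * W' i = 1
  inv_mul : ∀ i, W' i * W i = 1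

/-- The generators of the next level, `X i (e i + {W i})`. -/
def extGen (q : ℂ) (N : ℕ) (e X W W' : ℕ → A) (i : ℕ) : A :=
  if i < N then X i * (e i + (q - q⁻¹)⁻¹ • (W i - W' i)) else 0

/-- The product `X j X (j+1) ⋯ X (j+t)`. -/
def xprod (X : ℕ → A) (j : ℕ) : ℕ → A
  | 0 => X j
  | t + 1 => xprod X j t * X (j + t + 1)

theorem QComm.eq {s : ℂ} {a b : A} (h : QComm s a b) : a * b = s • (b * a) := h

theorem QComm.left_assoc {s : ℂ} {a b : A} (h : QComm s a b) (c : A) :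
    a * (b * c) = s • (b * (a * c)) := by
  rw [← mul_assoc, h, smul_mul_assoc, mul_assoc]

theorem QComm.xprod {X : ℕ → A} {a : A} {j t : ℕ}
    (h : ∀ i, j ≤ i → i ≤ j + t → QComm 1 a (X i)) : QComm 1 a (xprod X j t) := by
  induction t with
  | zero => exact h j le_rfl le_rfl
  | succ t ih =>
    exact ((ih fun i h₁ h₂ => h i h₁ (by omega)).mul_right
      (h _ (by omega) (by omega))).of_eq (one_mul 1)

theorem extGen_of_le {q : ℂ} {N : ℕ} {e X W W' : ℕ → A} {i : ℕ} (h : N ≤ i) :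
    extGen q N e X W W' i = 0 := if_neg h.not_gt

namespace QExtension

variable {q : ℂ} {N : ℕ} {e X W W' : ℕ → A}

local notation "E" => extGen q N e X W W'

theorem inv (h : QExtension q N e X W W') {s : ℂ} (hs : s ≠ 0) {i : ℕ} {b : A}
    (hb : QComm s (W i) b) : QComm s⁻¹ (W' i) b :=
  hb.inv_left hs (h.mul_inv i) (h.inv_mul i)

theorem inv_one (h : QExtension q N e X W W') {i : ℕ} {b : A}
    (hb : QComm 1 (W i) b) : QComm 1 (W' i) b :=
  (h.inv one_ne_zero hb).of_eq _root_.inv_one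

theorem comm_extGen (h : QExtension q N e X W W') {s : ℂ} {a : A} {i : ℕ}
    (h₁ : QComm s a (X i)) (h₂ : QComm 1 a (e i)) (h₃ : QComm 1 a (W i)) : QComm s a (E i) := by
  unfold extGen
  split_ifs
  · exact (h₁.mul_right (h₂.add_right
      ((h₃.sub_right (h.inv_one h₃.symm_one).symm_one).smul_right _))).of_eq (mul_one s)
  · exact QComm.zero_right

theorem X_extGen (h : QExtension q N e X W W') {i j : ℕ} (h₁ : i ≠ j) (h₂ : i ≠ j + 1) :
    QComm 1 (X i) (E j) :=
  h.comm_extGen (h.XX i j) (h.Xe i j) (h.WX j i h₁ h₂).symm_one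

theorem W_extGen_succ (h : QExtension q N e X W W') {i : ℕ} (hi : i + 1 < N) :
    QComm q (W i) (E (i + 1)) :=
  h.comm_extGen (h.WX_succ i hi) (h.We i (i + 1) (by omega) (by omega)) (h.WW i (i + 1))

theorem W_extGen (h : QExtension q N e X W W') {i j : ℕ} (hij : i + 2 ≤ j) :
    QComm 1 (W i) (E j) :=
  h.comm_extGen (h.WX i j (by omega) (by omega)) (h.We i j (by omega) (by omega)) (h.WW i j)

theorem e_extGen (h : QExtension q N e X W W') (he : QSerre q e) {i j : ℕ} (hij : i + 2 ≤ j) :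
    QComm 1 (e i) (E j) :=
  h.comm_extGen (h.Xe j i).symm_one (he.far i j hij) (h.We j i (by omega) (by omega)).symm_one

theorem X_rootVec (h : QExtension q N e X W W') (i j t : ℕ) : QComm 1 (X i) (rootVec q e j t) :=
  QComm.rootVec_one fun k _ _ => h.Xe i k

theorem W_rootVec_last (h : QExtension q N e X W W') (j t : ℕ) :
    QComm q (W (j + t + 1)) (rootVec q e j t) := by
  cases t with
  | zero => exact h.We_pred j
  | succ t =>
    have : QComm 1 (W (j + (t + 1) + 1)) (rootVec q e j t) :=
      QComm.rootVec_one fun i _ _ => h.We _ i (by omega) (by omega)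
    exact (this.rootVec_succ (h.We_pred _)).of_eq (one_mul q)

theorem W_rootVec_first (h : QExtension q N e X W W') (j t : ℕ) :
    QComm q⁻¹ (W j) (rootVec q e j t) := by
  induction t with
  | zero => exact h.We_self j
  | succ t ih => exact (ih.rootVec_succ (h.We j _ (by omega) (by omega))).of_eq (mul_one _)

theorem W_rootVec_mid (h : QExtension q N e X W W') (hq : q ≠ 0) (j t : ℕ) :
    QComm 1 (W (j + t + 1)) (rootVec q e j (t + 1)) :=
  ((h.W_rootVec_last j t).rootVec_succ (h.We_self _)).of_eq (mul_inv_cancel₀ hq)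

theorem W_xprod_last (h : QExtension q N e X W W') {j t : ℕ} (hN : j + t + 1 < N) :
    QComm q⁻¹ (W (j + t + 1)) (xprod X j (t + 1)) := by
  have : QComm 1 (W (j + t + 1)) (xprod X j t) :=
    QComm.xprod fun i _ _ => h.WX _ i (by omega) (by omega)
  exact (this.mul_right (h.WX_self _ hN)).of_eq (one_mul _)

theorem W_xprod_first (h : QExtension q N e X W W') (hq : q ≠ 0) {j t : ℕ} (hN : j + t + 1 < N) :
    QComm 1 (W j) (xprod X j (t + 1)) := by
  induction t with
  | zero => exact ((h.WX_self j (by omega)).mul_right (h.WX_succ j hN)).of_eq (inv_mul_cancel₀ hq)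
  | succ t ih =>
    exact ((ih (by omega)).mul_right (h.WX j _ (by omega) (by omega))).of_eq (one_mul 1)

theorem rootVec_bracket (h : QExtension q N e X W W') (hq : q ≠ 0) (hq1 : q ^ 2 - 1 ≠ 0)
    {j t : ℕ} (hN : j + t + 1 < N) :
    rootVec q e j t * E (j + t + 1) - q • (E (j + t + 1) * rootVec q e j t) =
      X (j + t + 1) * (rootVec q e j (t + 1) - W (j + t + 1) * rootVec q e j t) := by
  have hw := h.W_rootVec_last j t
  have hv := (h.inv hq hw).symm (inv_ne_zero hq)
  rw [inv_inv] at hv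
  replace hw := hw.symm hq
  have hx := (h.X_rootVec (j + t + 1) j t).symm_one
  have hc : (q - q⁻¹)⁻¹ = q / (q ^ 2 - 1) := by
    have : q - q⁻¹ = (q ^ 2 - 1) / q := by field_simp
    rw [this, inv_div]
  rw [extGen, if_pos hN, rootVec, hc]
  simp only [mul_add, add_mul, mul_sub, sub_mul, smul_mul_assoc, mul_smul_comm, mul_assoc,
    smul_add, smul_sub, hw.eq, hv.eq, hx.left_assoc, one_smul, smul_smul]
  match_scalars <;> field_simp <;> ring

theorem extGen_Y_first (h : QExtension q N e X W W') (hq : q ≠ 0) {j : ℕ} (hN : j + 1 < N) :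
    QComm q⁻¹ (X j * W' j) (E (j + 1)) :=
  ((h.X_extGen (by omega) (by omega)).mul_left (h.inv hq (h.W_extGen_succ hN))).of_eq (one_mul _)

theorem extGen_Y (h : QExtension q N e X W W') {i j : ℕ} (hij : i + 2 ≤ j) :
    QComm 1 (X i * W' i) (E j) :=
  ((h.X_extGen (by omega) (by omega)).mul_left (h.inv_one (h.W_extGen hij))).of_eq (one_mul _)

theorem rootVec_extGen (h : QExtension q N e X W W') (he : QSerre q e) (hq : q ≠ 0)
    (hq1 : q ^ 2 - 1 ≠ 0) {j t : ℕ} (hN : j + t + 1 < N) :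
    rootVec q E j (t + 1) =
      xprod X j (t + 1) * (rootVec q e j (t + 1) - W (j + t + 1) * rootVec q e j t) +
        q • (X j * W' j * rootVec q E (j + 1) t) := by
  induction t with
  | zero =>
    have hb := h.rootVec_bracket hq hq1 (j := j) (t := 0) hN
    have hx := (h.X_extGen (j := j + 1) (i := j) (by omega) (by omega)).symm_one
    have hw := (h.W_extGen_succ hN).symm hq
    have hv := (h.inv hq (h.W_extGen_succ hN)).symm (inv_ne_zero hq)
    rw [inv_inv] at hv
    have hc : (q - q⁻¹)⁻¹ = q / (q ^ 2 - 1) := by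
      have : q - q⁻¹ = (q ^ 2 - 1) / q := by field_simp
      rw [this, inv_div]
    have h₀ : E j = X j * (e j + (q - q⁻¹)⁻¹ • (W j - W' j)) := if_pos (by omega)
    change e j * E (j + 1) - q • (E (j + 1) * e j) = X (j + 1) * _ at hb
    change E j * E (j + 1) - q • (E (j + 1) * E j) = X j * X (j + 1) * _ +
      q • (X j * W' j * E (j + 1))
    rw [mul_assoc (X j) (X (j + 1)), add_zero, ← hb, h₀, hc]
    generalize E (j + 1) = f at *
    simp only [mul_add, add_mul, mul_sub, sub_mul, smul_mul_assoc, mul_smul_comm, mul_assoc,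
      smul_add, smul_sub, hx.left_assoc, hw.eq, hv.eq, one_smul, smul_smul]
    match_scalars <;> field_simp <;> ring
  | succ t ih =>
    have hb := h.rootVec_bracket hq hq1 (j := j) (t := t + 1) hN
    have hm : QComm 1 (E (j + (t + 1) + 1)) (xprod X j (t + 1)) :=
      QComm.xprod fun i _ _ => (h.X_extGen (by omega) (by omega)).symm_one
    have hw : QComm q (W (j + t + 1)) (E (j + (t + 1) + 1)) := h.W_extGen_succ hN
    replace hw := hw.symm hq
    have hr : QComm 1 (rootVec q e j t) (E (j + (t + 1) + 1)) :=
      (QComm.rootVec_one fun i _ _ => (h.e_extGen he (by omega)).symm_one).symm_one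
    have hy : QComm 1 (E (j + (t + 1) + 1)) (X j * W' j) := (h.extGen_Y (by omega)).symm_one
    have hE : rootVec q E (j + 1) (t + 1) = rootVec q E (j + 1) t * E (j + (t + 1) + 1) -
        q • (E (j + (t + 1) + 1) * rootVec q E (j + 1) t) := by
      rw [rootVec, show j + 1 + t + 1 = j + (t + 1) + 1 by omega]
    rw [rootVec.eq_2 q E j (t + 1), ih (by omega), hE, xprod.eq_2 X j (t + 1),
      mul_assoc (xprod X j (t + 1)),
      ← hb]
    generalize E (j + (t + 1) + 1) = f at *
    generalize X j * W' j = y at *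
    simp only [mul_add, add_mul, mul_sub, sub_mul, smul_mul_assoc, mul_smul_comm, mul_assoc,
      smul_add, smul_sub, hr.eq, hm.left_assoc, hw.left_assoc,
      hy.left_assoc, one_smul, smul_smul]
    match_scalars <;> field_simp
    ring

theorem extGen_far (h : QExtension q N e X W W') (he : QSerre q e) {i j : ℕ} (hij : i + 2 ≤ j) :
    QComm 1 (E i) (E j) := by
  have hX : QComm 1 (X i) (E j) := h.X_extGen (by omega) (by omega)
  exact (h.comm_extGen hX.symm_one (h.e_extGen he hij).symm_one (h.W_extGen hij).symm_one).symm_one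

theorem rootVec_one_comm_right (h : QExtension q N e X W W') (he : QSerre q e) (hq : q ≠ 0)
    (hq1 : q ^ 2 - 1 ≠ 0) (i : ℕ) : QComm q⁻¹ (rootVec q E i 1) (E (i + 1)) := by
  rcases le_or_gt N (i + 1) with hN | hN
  · rw [extGen_of_le hN]
    exact QComm.zero_right
  have hc : (q - q⁻¹)⁻¹ = q / (q ^ 2 - 1) := by
    have : q - q⁻¹ = (q ^ 2 - 1) / q := by field_simp
    rw [this, inv_div]
  have hY := h.extGen_Y_first hq hN
  have hX : QComm 1 (X i) (E (i + 1)) := h.X_extGen (by omega) (by omega)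
  have hB : QComm q⁻¹ (X (i + 1) * (rootVec q e i 1 - W (i + 1) * e i)) (E (i + 1)) := by
    have hwx := h.WX_self _ hN
    have hvx := h.inv (inv_ne_zero hq) hwx
    have hwe := (h.We_pred i).symm hq
    have hve := (h.inv hq (h.We_pred i)).symm (inv_ne_zero hq)
    have hwf := (h.We_self (i + 1)).symm (inv_ne_zero hq)
    have hwd := (h.W_rootVec_mid hq i 0).symm_one
    have hvd := (h.inv_one (h.W_rootVec_mid hq i 0)).symm_one
    have hxe := (h.Xe (i + 1) i).symm_one
    have hxf := (h.Xe (i + 1) (i + 1)).symm_one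
    have hxd := (h.X_rootVec (i + 1) i 1).symm_one
    have hdf := he.right i
    have hef : e i * e (i + 1) = rootVec q e i 1 + q • (e (i + 1) * e i) := by
      simp [rootVec]
    have hvw := h.inv_mul (i + 1)
    have hvw' := h.mul_inv (i + 1)
    have hi₁ : ∀ z, W' (i + 1) * (W (i + 1) * z) = z := fun z => by rw [← mul_assoc, hvw, one_mul]
    have hi₂ : ∀ z, W (i + 1) * (W' (i + 1) * z) = z := fun z => by rw [← mul_assoc, hvw', one_mul]
    simp only [add_zero, zero_add] at hwd hvd
    rw [extGen, if_pos hN, hc]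
    generalize rootVec q e i 1 = d at *
    unfold QComm
    simp only [mul_add, add_mul, mul_sub, sub_mul, smul_mul_assoc, mul_smul_comm, mul_assoc,
      smul_add, smul_sub, smul_smul, one_smul, inv_inv, hwx.left_assoc, hvx.left_assoc,
      hwe.eq, hve.eq, hwf.left_assoc, hwd.eq, hvd.eq, hxe.left_assoc, hxf.left_assoc,
      hxd.left_assoc, hdf.eq, hef, hi₁, hi₂]
    match_scalars <;> field_simp
    ring
  have hx : QComm q⁻¹ (xprod X i 1 * (rootVec q e i 1 - W (i + 1) * e i)) (E (i + 1)) := by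
    rw [xprod, xprod, add_zero, mul_assoc]
    exact (hX.mul_left hB).of_eq (one_mul _)
  rw [h.rootVec_extGen he hq hq1 (t := 0) hN]
  refine hx.add_left (QComm.smul_left q ?_)
  exact (hY.mul_left (QComm.of_commute (Commute.refl _))).of_eq (mul_one _)

theorem rootVec_one_comm_left (h : QExtension q N e X W W') (he : QSerre q e) (hq : q ≠ 0)
    (hq1 : q ^ 2 - 1 ≠ 0) (i : ℕ) : QComm q (rootVec q E i 1) (E i) := by
  rcases le_or_gt N (i + 1) with hN | hN
  · rw [rootVec_eq_zero (extGen_of_le hN)]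
    exact QComm.zero_left
  have hc : (q - q⁻¹)⁻¹ = q / (q ^ 2 - 1) := by
    have : q - q⁻¹ = (q ^ 2 - 1) / q := by field_simp
    rw [this, inv_div]
  have hxy := h.XX (i + 1) i
  have huy := h.WX_self i (by omega)
  have hty := h.inv (inv_ne_zero hq) huy
  have hwy := h.WX (i + 1) i (by omega) (by omega)
  have hvy := h.inv_one hwy
  have hdy := (h.X_rootVec i i 1).symm_one
  have hey := (h.Xe i i).symm_one
  have hfy := (h.Xe i (i + 1)).symm_one
  have hex := (h.Xe (i + 1) i).symm_one
  have hux := h.WX_succ i hN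
  have htx := h.inv hq hux
  have hwu := h.WW (i + 1) i
  have hvu := h.inv_one hwu
  have hwt := (h.inv_one (h.WW i (i + 1))).symm_one
  have hvt := h.inv_one hwt
  have hdu := (h.W_rootVec_first i 1).symm (inv_ne_zero hq)
  have hdt := (h.inv (inv_ne_zero hq) (h.W_rootVec_first i 1)).symm (by simpa)
  have heu := (h.We_self i).symm (inv_ne_zero hq)
  have het := (h.inv (inv_ne_zero hq) (h.We_self i)).symm (by simpa)
  have hfu := (h.We i (i + 1) (by omega) (by omega)).symm_one
  have hft := (h.inv_one (h.We i (i + 1) (by omega) (by omega))).symm_one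
  have hew := (h.We_pred i).symm hq
  have hev := (h.inv hq (h.We_pred i)).symm (inv_ne_zero hq)
  have hde := he.left i
  have hef : e i * e (i + 1) = rootVec q e i 1 + q • (e (i + 1) * e i) := by
    simp [rootVec]
  have hut : ∀ z, W i * (W' i * z) = z := fun z => by rw [← mul_assoc, h.mul_inv, one_mul]
  have htu : ∀ z, W' i * (W i * z) = z := fun z => by rw [← mul_assoc, h.inv_mul, one_mul]
  rw [h.rootVec_extGen he hq hq1 (t := 0) hN]
  change QComm q (X i * X (i + 1) * (rootVec q e i 1 - W (i + 1) * e i) +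
    q • (X i * W' i * E (i + 1))) _
  rw [extGen, extGen, if_pos hN, if_pos (by omega), hc]
  generalize rootVec q e i 1 = d at *
  unfold QComm
  simp only [mul_add, add_mul, mul_sub, sub_mul, smul_mul_assoc, mul_smul_comm, mul_assoc,
    smul_add, smul_sub, smul_smul, one_smul, inv_inv, hxy.left_assoc, huy.left_assoc,
    hty.left_assoc, hwy.left_assoc, hvy.left_assoc, hdy.left_assoc, hey.left_assoc,
    hfy.left_assoc, hex.left_assoc, hux.left_assoc, htx.left_assoc, hwu.eq, hwu.left_assoc,
    hvu.eq, hwt.eq, hwt.left_assoc, hvt.eq, hdu.eq, hdt.eq,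
    heu.eq, het.eq, het.left_assoc, hfu.eq, hft.eq,
    hew.eq, hew.left_assoc, hev.eq, hde.eq, hef, hut, htu]
  match_scalars <;> field_simp
  ring

theorem extGen_qSerre (h : QExtension q N e X W W') (he : QSerre q e) (hq : q ≠ 0)
    (hq1 : q ^ 2 - 1 ≠ 0) : QSerre q E where
  far _ _ hij := h.extGen_far he hij
  left := h.rootVec_one_comm_left he hq hq1
  right := h.rootVec_one_comm_right he hq hq1

theorem extGen_pow_eq_zero (h : QExtension q N e X W W') {l : ℕ} (hl : 0 < l) (hodd : Odd l)
    (hq : IsPrimitiveRoot q l) (hW : ∀ i, W i ^ l = 1) (hW' : ∀ i, W' i ^ l = 1) {i : ℕ}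
    (he : e i ^ l = 0) : E i ^ l = 0 := by
  have hq0 : q ≠ 0 := hq.ne_zero hl.ne'
  have hq2 : IsPrimitiveRoot (q ^ 2) l := hq.pow_of_coprime 2 hodd.coprime_two_left
  have hch : q ^ l.choose 2 = 1 := by
    obtain ⟨m, rfl⟩ := hodd
    rw [Nat.choose_two_right, Nat.add_sub_cancel, mul_left_comm, Nat.mul_div_cancel_left _ two_pos,
      pow_mul, hq.pow_eq_one, one_pow]
  unfold extGen
  split_ifs with hi
  swap
  · exact zero_pow hl.ne'
  generalize (q - q⁻¹)⁻¹ = c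
  have hWX := h.WX_self i hi
  have hW'X : QComm q (W' i) (X i) := (h.inv (inv_ne_zero hq0) hWX).of_eq (inv_inv q)
  have hW'e : QComm q (W' i) (e i) :=
    (h.inv (inv_ne_zero hq0) (h.We_self i)).of_eq (inv_inv q)
  have hXW : QComm q (X i) (W i) := (hWX.symm (inv_ne_zero hq0)).of_eq (inv_inv q)
  have heW : QComm q (e i) (W i) := ((h.We_self i).symm (inv_ne_zero hq0)).of_eq (inv_inv q)
  have heX := (h.Xe i i).symm_one
  have hW'W : QComm 1 (W' i) (W i) := h.inv_one (h.WW i i)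
  have h₁ : QComm (q ^ 2) (X i * e i) (c • (X i * W i)) := by
    refine QComm.smul_right c (((h.XX i i).mul_left heX).mul_right (hXW.mul_left heW) |>.of_eq ?_)
    ring
  have h₂ : QComm (q ^ 2) (-c • (X i * W' i)) (c • (X i * W i) + X i * e i) := by
    refine QComm.smul_left (-c) (QComm.add_right (QComm.smul_right c ?_) ?_)
    · exact (((h.XX i i).mul_left hW'X).mul_right (hXW.mul_left hW'W)).of_eq (by ring)
    · exact (((h.XX i i).mul_left hW'X).mul_right ((h.Xe i i).mul_left hW'e)).of_eq (by ring)
  have hsplit : X i * (e i + c • (W i - W' i)) =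
      c • (X i * W i) + X i * e i + -c • (X i * W' i) := by
    rw [mul_add, mul_smul_comm, mul_sub]; module
  rw [hsplit, QComm.add_pow_primitiveRoot hq2 hl h₂, QComm.add_pow_primitiveRoot hq2 hl h₁,
    heX.mul_pow_eq_zero he, smul_pow, smul_pow, hWX.mul_pow, hW'X.mul_pow, hW, hW', inv_pow, hch,
    hodd.neg_pow]
  simp

theorem rootVec_extGen_pow_eq_zero (h : QExtension q N e X W W') (he : QSerre q e) {l : ℕ}
    (hl₀ : 0 < l) (hodd : Odd l) (hq : IsPrimitiveRoot q l) (hq1 : q ^ 2 - 1 ≠ 0)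
    (hq2 : 1 + q ^ 2 ≠ 0) (hW : ∀ i, W i ^ l = 1) (hW' : ∀ i, W' i ^ l = 1)
    (hpow : ∀ j t, rootVec q e j t ^ l = 0) (j t : ℕ) : rootVec q E j t ^ l = 0 := by
  have hq0 : q ≠ 0 := hq.ne_zero hl₀.ne'
  have hqsq : IsPrimitiveRoot (q ^ 2) l := hq.pow_of_coprime 2 hodd.coprime_two_left
  induction t generalizing j with
  | zero => exact h.extGen_pow_eq_zero hl₀ hodd hq hW hW' (hpow j 0)
  | succ t ih =>
    rcases le_or_gt N (j + t + 1) with hN | hN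
    · rw [rootVec_eq_zero (t := t + 1) (extGen_of_le hN), zero_pow hl₀.ne']
    have hE := h.extGen_qSerre he hq0 hq1
    have hroot := h.rootVec_extGen he hq0 hq1 hN
    have htail := hE.comm_rootVec_tail hq0 hq2 j t
    rw [hroot] at htail ⊢
    set M := xprod X j (t + 1) with hM
    set r₁ := rootVec q e j (t + 1)
    set r₀ := rootVec q e j t
    set w := W (j + t + 1)
    set Z := rootVec q E (j + 1) t
    set Y := X j * W' j
    have hYZ : QComm q⁻¹ Y Z := by
      have : ∀ s, QComm q⁻¹ Y (rootVec q E (j + 1) s) := fun s => by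
        induction s with
        | zero => exact h.extGen_Y_first hq0 (by omega)
        | succ s ih' => exact (ih'.rootVec_succ (h.extGen_Y (by omega))).of_eq (mul_one _)
      exact this t
    have hQZ : QComm q⁻¹ (q • (Y * Z)) Z :=
      QComm.smul_left q ((hYZ.mul_left (QComm.of_commute (Commute.refl Z))).of_eq (mul_one _))
    have hPZ : QComm q⁻¹ (M * (r₁ - w * r₀)) Z := by
      simpa using htail.sub_left hQZ
    have hMM : QComm 1 M M := QComm.of_commute (Commute.refl M)
    have hXM : ∀ i, QComm 1 (X i) M := fun i => QComm.xprod fun k _ _ => h.XX i k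
    have hMr₁ : QComm 1 M r₁ := (QComm.rootVec_one fun k _ _ =>
      (QComm.xprod fun i _ _ => (h.Xe i k).symm_one).symm_one)
    have hMr₀ : QComm 1 M r₀ := (QComm.rootVec_one fun k _ _ =>
      (QComm.xprod fun i _ _ => (h.Xe i k).symm_one).symm_one)
    have hMw : QComm q M w :=
      ((h.W_xprod_last hN).symm (inv_ne_zero hq0)).of_eq (inv_inv q)
    have hr₁w : QComm 1 r₁ w := (h.W_rootVec_mid hq0 j t).symm_one
    have hr : QComm q r₁ r₀ := he.comm_rootVec_same hq0 hq2 j t.lt_succ_self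
    have hr₀w : QComm q⁻¹ r₀ w := (h.W_rootVec_last j t).symm hq0
    have hp : QComm (q ^ 2) (M * r₁) (-(M * w * r₀)) := by
      have := ((hMM.mul_right hMw).mul_right hMr₀).mul_left
        ((hMr₁.symm_one.mul_right hr₁w).mul_right hr)
      simpa using QComm.smul_right (-1) (this.of_eq (by ring : _ = q ^ 2))
    have hP : (M * (r₁ - w * r₀)) ^ l = 0 := by
      have h₁ : (M * r₁) ^ l = 0 := hMr₁.symm_one.mul_pow_eq_zero (hpow _ _)
      have h₂ : (M * w * r₀) ^ l = 0 :=
        (hMr₀.symm_one.mul_right hr₀w).mul_pow_eq_zero (hpow _ _)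
      rw [show M * (r₁ - w * r₀) = -(M * w * r₀) + M * r₁ by rw [mul_sub, mul_assoc]; abel,
        QComm.add_pow_primitiveRoot hqsq hl₀ hp, hodd.neg_pow, h₁, h₂, neg_zero, add_zero]
    have hYW : ∀ {s : ℂ} {a : A}, s ≠ 0 → QComm 1 (X j) a → QComm s (W j) a → QComm s a Y :=
      fun {s a} hs h₁ h₂ => by
        have := (h.inv hs h₂).symm (inv_ne_zero hs)
        exact (h₁.symm_one.mul_right (this.of_eq (inv_inv s))).of_eq (one_mul s)
    have hMY : QComm 1 M Y := hYW one_ne_zero (hXM j) (h.W_xprod_first hq0 hN)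
    have hr₁Y : QComm q⁻¹ r₁ Y :=
      hYW (inv_ne_zero hq0) (h.X_rootVec _ _ _) (h.W_rootVec_first j (t + 1))
    have hr₀Y : QComm q⁻¹ r₀ Y :=
      hYW (inv_ne_zero hq0) (h.X_rootVec _ _ _) (h.W_rootVec_first j t)
    have hwY : QComm 1 w Y :=
      hYW one_ne_zero (h.WX _ j (by omega) (by omega)).symm_one (h.WW _ _)
    have hPY : QComm q⁻¹ (M * (r₁ - w * r₀)) Y :=
      (hMY.mul_left (hr₁Y.sub_left ((hwY.mul_left hr₀Y).of_eq (one_mul _)))).of_eq (one_mul _)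
    have hPQ := (QComm.smul_right q (hPY.mul_right hPZ)).symm
      (mul_ne_zero (inv_ne_zero hq0) (inv_ne_zero hq0))
    have hQ : (q • (Y * Z)) ^ l = 0 := by
      rw [smul_pow, ((hYZ.symm (inv_ne_zero hq0)).mul_pow_eq_zero (ih (j + 1))), smul_zero]
    rw [QComm.add_pow_primitiveRoot hqsq hl₀ (hPQ.of_eq (by field_simp)), hP, hQ, add_zero]

end QExtension
end Extension

section Operators

variable {l n : ℕ}

theorem shiftOp_um (ξ m : Mt l n) : shiftOp ξ (um m) = um (m + ξ) :=
  Finsupp.mapDomain_single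

theorem diagOp_um (f : Mt l n → ℂ) (m : Mt l n) : diagOp f (um m) = f m • um m := by
  simp [diagOp, um]

theorem end_ext_um {f g : Module.End ℂ (Vsp l n)} (h : ∀ m, f (um m) = g (um m)) : f = g :=
  Finsupp.lhom_ext' fun m => LinearMap.ext_ring (h m)

theorem shiftOp_mul (ξ η : Mt l n) : shiftOp ξ * shiftOp η = shiftOp (ξ + η) :=
  end_ext_um fun m => by
    rw [Module.End.mul_apply, shiftOp_um, shiftOp_um, shiftOp_um, add_assoc, add_comm η]

theorem shiftOp_zero : shiftOp (0 : Mt l n) = 1 :=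
  end_ext_um fun m => by rw [shiftOp_um, add_zero, Module.End.one_apply]

theorem shiftOp_pow (ξ : Mt l n) (k : ℕ) : shiftOp ξ ^ k = shiftOp (k • ξ) := by
  induction k with
  | zero => rw [pow_zero, zero_smul, shiftOp_zero]
  | succ k ih => rw [pow_succ, ih, shiftOp_mul, succ_nsmul]

theorem shiftOp_pow_card (ξ : Mt l n) : shiftOp ξ ^ l = 1 := by
  rw [shiftOp_pow, show l • ξ = 0 by ext; simp, shiftOp_zero]

theorem shiftOp_comm (ξ η : Mt l n) : QComm 1 (shiftOp ξ) (shiftOp η) :=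
  QComm.of_commute (by rw [Commute, SemiconjBy, shiftOp_mul, shiftOp_mul, add_comm])

theorem Xop_comm (ε : ℂ) (j k j' k' : ℕ) : QComm 1 (Xop l n ε j k) (Xop l n ε j' k') :=
  QComm.of_commute <| end_ext_um fun m => by
    simp only [Xop, Module.End.mul_apply, diagOp_um, map_smul]
    rw [smul_comm]

theorem mval_add (ξ η : Mt l n) (j k : ℕ) : mval (ξ + η) j k = mval ξ j k + mval η j k := by
  unfold mval; split_ifs <;> simp

theorem mval_sub (ξ η : Mt l n) (j k : ℕ) : mval (ξ - η) j k = mval ξ j k - mval η j k := by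
  unfold mval; split_ifs <;> simp

theorem mval_neg (ξ : Mt l n) (j k : ℕ) : mval (-ξ) j k = -mval ξ j k := by
  unfold mval; split_ifs <;> simp

theorem mval_dlt (a b j k : ℕ) : mval (dlt a b : Mt l n) j k =
    if (1 ≤ j ∧ j ≤ k ∧ k ≤ n) ∧ j = a ∧ k = b then 1 else 0 := by
  unfold mval dlt
  by_cases h : 1 ≤ j ∧ j ≤ k ∧ k ≤ n <;> simp [h]

theorem epow_zero {ε : ℂ} : epow ε (0 : ZMod l) = 1 := by rw [epow, ZMod.val_zero, pow_zero]

theorem epow_one {ε : ℂ} [Fact (1 < l)] : epow ε (1 : ZMod l) = ε := by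
  rw [epow, ZMod.val_one, pow_one]

section Epow

variable [NeZero l] {ε : ℂ}

theorem epow_add (hε : ε ^ l = 1) (a b : ZMod l) : epow ε (a + b) = epow ε a * epow ε b := by
  rw [epow, epow, epow, ZMod.val_add, ← pow_add, ← pow_eq_pow_mod _ hε]

theorem epow_neg (hε : ε ^ l = 1) (a : ZMod l) : epow ε (-a) = (epow ε a)⁻¹ :=
  eq_inv_of_mul_eq_one_left (by rw [← epow_add hε, neg_add_cancel, epow_zero])

theorem shiftOp_Xop (hε : ε ^ l = 1) (ξ : Mt l n) (j k : ℕ) :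
    QComm (epow ε (-mval ξ j k)) (shiftOp ξ) (Xop l n ε j k) :=
  end_ext_um fun m => by
    simp only [Xop, Module.End.mul_apply, diagOp_um, map_smul, shiftOp_um, LinearMap.smul_apply,
      mval_add, smul_smul, ← epow_add hε]
    congr 2
    abel

theorem shiftOp_Xop_of_eq_zero (hε : ε ^ l = 1) {ξ : Mt l n} {j k : ℕ} (h : mval ξ j k = 0) :
    QComm 1 (shiftOp ξ) (Xop l n ε j k) :=
  (shiftOp_Xop hε ξ j k).of_eq (by rw [h, neg_zero, epow_zero])

end Epow

theorem mval_zetaE (i m j k : ℕ) : mval (zetaE l n (i + 1) (m + 1)) j k =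
    (if (1 ≤ j ∧ j ≤ k ∧ k ≤ n) ∧ j = i + 1 ∧ k = m + 1 then 1 else 0) +
    (if (1 ≤ j ∧ j ≤ k ∧ k ≤ n) ∧ j = i + 1 ∧ k = m then 1 else 0) -
    (if (1 ≤ j ∧ j ≤ k ∧ k ≤ n) ∧ j = i ∧ k = m then 1 else 0) -
    (if (1 ≤ j ∧ j ≤ k ∧ k ≤ n) ∧ j = i + 2 ∧ k = m + 1 then 1 else 0) := by
  rw [zetaE, mval_sub, mval_sub, mval_add, mval_dlt, mval_dlt, mval_dlt, mval_dlt]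
  rfl

/-- The operators `Σ_{k=i+1}^m X_{i+1,k} ⋯ X_{i+1,m} {…}`, whose last level `m = n` consists of
the `E_{i+1}`. -/
def levelGen (l n : ℕ) (ε : ℂ) : ℕ → ℕ → Module.End ℂ (Vsp l n)
  | 0 => fun _ => 0
  | m + 1 => extGen ε (m + 1) (levelGen l n ε m) (fun i => Xop l n ε (i + 1) (m + 1))
      (fun i => shiftOp (zetaE l n (i + 1) (m + 1)))
      (fun i => shiftOp (-zetaE l n (i + 1) (m + 1)))

variable {ε : ℂ}

theorem levelGen_of_le {m i : ℕ} (h : m ≤ i) : levelGen l n ε m i = 0 := by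
  cases m with
  | zero => rfl
  | succ m => exact extGen_of_le h

theorem shiftOp_levelGen [NeZero l] (hε : ε ^ l = 1) (ξ : Mt l n) (j m : ℕ)
    (h : ∀ k < m, mval ξ (j + 1) k = 0) :
    QComm (epow ε (-mval ξ (j + 1) m)) (shiftOp ξ) (levelGen l n ε m j) := by
  induction m with
  | zero => exact QComm.zero_right
  | succ m ih =>
    rw [levelGen, extGen]
    split_ifs
    · have := (ih fun k hk => h k (by omega)).of_eq (t := 1)
        (by rw [h m m.lt_succ_self, neg_zero, epow_zero])
      exact ((shiftOp_Xop hε ξ _ _).mul_right (this.add_right (QComm.smul_right _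
        ((shiftOp_comm _ _).sub_right (shiftOp_comm _ _))))).of_eq (mul_one _)
    · exact QComm.zero_right

theorem mval_zetaE_of_lt {i m j k : ℕ} (h : m + 1 < k) :
    mval (zetaE l n (i + 1) (m + 1)) j k = 0 := by
  rw [mval_zetaE, if_neg (by omega), if_neg (by omega), if_neg (by omega), if_neg (by omega)]
  simp

theorem mval_zetaE_of_gt {i m j k : ℕ} (h : k < m) :
    mval (zetaE l n (i + 1) (m + 1)) j k = 0 := by
  rw [mval_zetaE, if_neg (by omega), if_neg (by omega), if_neg (by omega), if_neg (by omega)]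
  simp

theorem Xop_levelGen [NeZero l] (hε : ε ^ l = 1) (a j : ℕ) {k m : ℕ} (h : m < k) :
    QComm 1 (Xop l n ε a k) (levelGen l n ε m j) := by
  induction m with
  | zero => exact QComm.zero_right
  | succ m ih =>
    rw [levelGen, extGen]
    split_ifs
    · exact ((Xop_comm ε _ _ _ _).mul_right ((ih (by omega)).add_right (QComm.smul_right _
        ((shiftOp_Xop_of_eq_zero hε (mval_zetaE_of_lt h)).symm_one.sub_right
          (shiftOp_Xop_of_eq_zero hε
            (by rw [mval_neg, mval_zetaE_of_lt h, neg_zero])).symm_one)))).of_eq (mul_one _)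
    · exact QComm.zero_right

theorem levelGen_qExtension [NeZero l] [Fact (1 < l)] (hε : ε ^ l = 1) {m : ℕ} (hm : m + 1 ≤ n) :
    QExtension ε (m + 1) (levelGen l n ε m) (fun i => Xop l n ε (i + 1) (m + 1))
      (fun i => shiftOp (zetaE l n (i + 1) (m + 1)))
      (fun i => shiftOp (-zetaE l n (i + 1) (m + 1))) where
  XX _ _ := Xop_comm _ _ _ _ _
  Xe _ j := Xop_levelGen hε _ j m.lt_succ_self
  WW _ _ := shiftOp_comm _ _
  WX_self i hi := (shiftOp_Xop hε _ _ _).of_eq <| by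
    rw [mval_zetaE, if_pos (by omega), if_neg (by omega), if_neg (by omega), if_neg (by omega)]
    simp [epow_neg hε, epow_one]
  WX_succ i hi := (shiftOp_Xop hε _ _ _).of_eq <| by
    rw [mval_zetaE, if_neg (by omega), if_neg (by omega), if_neg (by omega), if_pos (by omega)]
    simp [epow_one]
  WX i j h₁ h₂ := shiftOp_Xop_of_eq_zero hε <| by
    rw [mval_zetaE, if_neg (by omega), if_neg (by omega), if_neg (by omega), if_neg (by omega)]
    simp
  We_self i := by
    rcases le_or_gt m i with hi | hi
    · rw [levelGen_of_le hi]; exact QComm.zero_right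
    refine (shiftOp_levelGen hε _ _ _ fun k hk => mval_zetaE_of_gt hk).of_eq ?_
    rw [mval_zetaE, if_neg (by omega), if_pos (by omega), if_neg (by omega), if_neg (by omega)]
    simp [epow_neg hε, epow_one]
  We_pred i := by
    rcases le_or_gt m i with hi | hi
    · rw [levelGen_of_le hi]; exact QComm.zero_right
    refine (shiftOp_levelGen hε _ _ _ fun k hk => mval_zetaE_of_gt hk).of_eq ?_
    rw [mval_zetaE, if_neg (by omega), if_neg (by omega), if_pos (by omega), if_neg (by omega)]
    simp [epow_one]
  We i j h₁ h₂ := by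
    refine (shiftOp_levelGen hε _ _ _ fun k hk => mval_zetaE_of_gt hk).of_eq ?_
    rw [mval_zetaE, if_neg (by omega), if_neg (by omega), if_neg (by omega), if_neg (by omega)]
    simp [epow_zero]
  mul_inv i := by rw [shiftOp_mul, add_neg_cancel, shiftOp_zero]
  inv_mul i := by rw [shiftOp_mul, neg_add_cancel, shiftOp_zero]

theorem levelGen_qSerre_and_pow (hl : 1 < l) (hodd : Odd l) (hε : IsPrimitiveRoot ε l)
    (h₁ : ε ^ 2 - 1 ≠ 0) (h₂ : 1 + ε ^ 2 ≠ 0) {m : ℕ} (hm : m ≤ n) :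
    QSerre ε (levelGen l n ε m) ∧ ∀ j t, rootVec ε (levelGen l n ε m) j t ^ l = 0 := by
  have : NeZero l := ⟨by omega⟩
  have : Fact (1 < l) := ⟨hl⟩
  induction m with
  | zero =>
    have hr : ∀ j t, rootVec ε (levelGen l n ε 0) j t = 0 := fun j t => rootVec_eq_zero rfl
    refine ⟨⟨fun _ _ _ => QComm.zero_left, fun i => ?_, fun i => ?_⟩, fun j t => ?_⟩
    · rw [hr]; exact QComm.zero_left
    · rw [hr]; exact QComm.zero_left
    · rw [hr, zero_pow (by omega)]
  | succ m ih =>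
    obtain ⟨hS, hp⟩ := ih (by omega)
    have hX := levelGen_qExtension hε.pow_eq_one hm
    exact ⟨hX.extGen_qSerre hS (hε.ne_zero (by omega)) h₁,
      hX.rootVec_extGen_pow_eq_zero hS (by omega) hodd hε h₁ h₂ (fun _ => shiftOp_pow_card _)
        (fun _ => shiftOp_pow_card _) hp⟩

theorem levelGen_eq_sum (m i : ℕ) : levelGen l n ε m i =
    ∑ k ∈ Finset.Icc (i + 1) m,
      (List.ofFn fun t : Fin (m + 1 - k) => Xop l n ε (i + 1) (k + t)).prod *
        braceShift l n ε 1 (zetaE l n (i + 1) k) := by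
  induction m with
  | zero => simp [levelGen]
  | succ m ih =>
    rcases le_or_gt (m + 1) i with hi | hi
    · rw [levelGen_of_le hi, Finset.Icc_eq_empty (by omega), Finset.sum_empty]
    have hprod : ∀ k ≤ m + 1,
        (List.ofFn fun t : Fin (m + 1 + 1 - k) => Xop l n ε (i + 1) (k + t)).prod =
          Xop l n ε (i + 1) (m + 1) *
            (List.ofFn fun t : Fin (m + 1 - k) => Xop l n ε (i + 1) (k + t)).prod := by
      intro k hk
      rw [Nat.succ_sub hk, List.ofFn_succ', List.concat_eq_append, List.prod_append,
        List.prod_singleton]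
      simp only [Fin.val_castSucc, Fin.val_last, Nat.add_sub_cancel' hk]
      refine (Commute.list_prod_right _ _ fun x hx => ?_).eq.symm
      obtain ⟨t, rfl⟩ := List.mem_ofFn.1 hx
      exact (Xop_comm ε _ _ _ _).eq_of_one
    rw [Finset.sum_congr rfl fun k hk => by rw [hprod k (Finset.mem_Icc.1 hk).2, mul_assoc],
      ← Finset.mul_sum, Finset.sum_Icc_succ_top (by omega), ← ih, levelGen, extGen, if_pos hi]
    simp [braceShift]

theorem Esp_eq_levelGen (i : ℕ) : Esp l n ε (i + 1) = levelGen l n ε n i :=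
  (levelGen_eq_sum n i).symm

end Operators

theorem long_products_of_e_vanish (l n : ℕ) (hlodd : Odd l) (hl : 1 < l)
    (ε : ℂ) (hε : IsPrimitiveRoot ε l) (hn : 1 ≤ n)
    (L : ℕ) (hL : (l - 1) * (n * (n + 1) * (n + 2)) / 6 < L)
    (idx : Fin L → ℕ) (hidx : ∀ t, 1 ≤ idx t ∧ idx t ≤ n) :
    (List.ofFn (fun t : Fin L => Esp l n ε (idx t))).prod = 0 := by
  have h₁ : ε ^ 2 - 1 ≠ 0 := fun h => by
    have := Nat.le_of_dvd two_pos (hε.dvd_of_pow_eq_one 2 (sub_eq_zero.1 h))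
    obtain ⟨k, rfl⟩ := hlodd
    omega
  have h₂ : 1 + ε ^ 2 ≠ 0 := fun h => by
    have hdvd : l ∣ 4 := hε.dvd_of_pow_eq_one 4 (by linear_combination (ε ^ 2 - 1) * h)
    have := Nat.le_of_dvd four_pos hdvd
    obtain ⟨k, rfl⟩ := hlodd
    obtain rfl : k = 1 := by omega
    omega
  obtain ⟨hS, hp⟩ := levelGen_qSerre_and_pow hl hlodd hε h₁ h₂ (le_refl n)
  have hlist : List.ofFn (fun t : Fin L => Esp l n ε (idx t)) =
      (List.ofFn fun t => idx t - 1).map (levelGen l n ε n) := by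
    rw [List.map_ofFn]
    congr 1
    funext t
    rw [Function.comp_apply, ← Esp_eq_levelGen, Nat.sub_add_cancel (hidx t).1]
  rw [hlist]
  refine hS.prod_eq_zero (j := 0) (d := n) (hε.ne_zero (by omega)) h₂ (by omega)
    (fun i hi => levelGen_of_le hi) hp (by omega) (fun i _ => i.zero_le) ?_
  rw [List.length_ofFn]
  rwa [← sum_heights, mul_left_comm, Nat.mul_div_cancel_left _ (by norm_num)] at hL
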